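/- Let H be an infinite-dimensional complex Hilbert space. Then C_1(H) fails the uniform λ-property; more precisely, inf{ λ(a) : a in the closed unit ball of C_1(H) } = 0. -/

import Mathlib

/-! Setting: `H` is a complex Hilbert space, and we consider the space `C₁(H)` of trace class
operators on `H` (more generally the Schatten classes `C_p(H)`), regarded as those bounded
operators `a : H →L[ℂ] H` that are compact and whose sequence of singular values is
`p`-summable. The singular values `μₙ(a)` of a compact operator `a` (the eigenvalues of
`|a| = (a^* a)^(1/2)` arranged in decreasing order and repeated according to multiplicity)
are realized here via the approximation numbers, which coincide with them. -/

/-- `sValue a n` is the `n`-th approximation number (`0`-indexed) of `a`, namely the distance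
from `a` to the operators of rank at most `n`.  For a compact operator on a Hilbert space this
coincides with the `(n+1)`-th singular value `μ_{n+1}(a)`, i.e. the `(n+1)`-th eigenvalue of
`|a| = (a^* a)^(1/2)` arranged in decreasing order and repeated according to multiplicity.  In
particular `sValue a 0 = μ₁(a) = ‖a‖`. -/
noncomputable def sValue {H : Type*} [NormedAddCommGroup H] [InnerProductSpace ℂ H]
    (a : H →L[ℂ] H) (n : ℕ) : ℝ :=
  sInf {r : ℝ | ∃ F : H →L[ℂ] H, LinearMap.rank (F : H →ₗ[ℂ] H) ≤ (n : Cardinal) ∧ r = ‖a - F‖}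

/-- Membership in the Schatten class `C_p(H)`: `a` is a compact operator with
`‖a‖_p^p = ∑ₙ μₙ(a)^p < ∞`. -/
def MemSchatten {H : Type*} [NormedAddCommGroup H] [InnerProductSpace ℂ H]
    (p : ℝ) (a : H →L[ℂ] H) : Prop :=
  IsCompactOperator a ∧ Summable (fun n => sValue a n ^ p)

/-- Membership in the trace class `C₁(H)`: `a` is a compact operator with
`‖a‖₁ = tr |a| = ∑ₙ μₙ(a) < ∞`. -/
def MemTraceClass {H : Type*} [NormedAddCommGroup H] [InnerProductSpace ℂ H]
    (a : H →L[ℂ] H) : Prop :=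
  IsCompactOperator a ∧ Summable (fun n => sValue a n)

/-- The trace norm `‖a‖₁ = tr |a| = ∑ₙ μₙ(a)`. -/
noncomputable def traceNorm {H : Type*} [NormedAddCommGroup H] [InnerProductSpace ℂ H]
    (a : H →L[ℂ] H) : ℝ :=
  ∑' n, sValue a n

/-- The closed unit ball of `C₁(H)` with respect to the trace norm `‖·‖₁`. -/
def traceBall (H : Type*) [NormedAddCommGroup H] [InnerProductSpace ℂ H] :
    Set (H →L[ℂ] H) :=
  {x | MemTraceClass x ∧ traceNorm x ≤ 1}

/-- The λ-function of Aron and Lohman on the closed unit ball of `C₁(H)`: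
`λ(a) = sup { t : (e, y, t) ∈ ∂ₑ(B) × B × [0,1] is a triplet amenable to a }`,
where a triplet `(e, y, t)` is amenable to `a` when `a = t • e + (1 - t) • y`. -/
noncomputable def lambdaFn {H : Type*} [NormedAddCommGroup H] [InnerProductSpace ℂ H]
    (a : H →L[ℂ] H) : ℝ :=
  sSup {t : ℝ | t ∈ Set.Icc (0 : ℝ) 1 ∧
    ∃ e ∈ Set.extremePoints ℝ (traceBall H), ∃ y ∈ traceBall H, a = t • e + (1 - t) • y}

/-- A minimal (i.e. rank-one) partial isometry: `e e^* e = e` and `e` has rank one. -/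
def IsMinimalPartialIsometry {H : Type*} [NormedAddCommGroup H] [InnerProductSpace ℂ H]
    [CompleteSpace H] (e : H →L[ℂ] H) : Prop :=
  e ∘L (ContinuousLinearMap.adjoint e) ∘L e = e ∧ LinearMap.rank (e : H →ₗ[ℂ] H) = 1

/-- The rank one operator `η ⊗ ξ : ζ ↦ ⟨ζ, ξ⟩ η` (Mathlib's inner product being conjugate
linear in the first variable, this is `ζ ↦ ⟪ξ, ζ⟫ • η`). -/
noncomputable def rankOneOp {H : Type*} [NormedAddCommGroup H] [InnerProductSpace ℂ H]
    (η ξ : H) : H →L[ℂ] H :=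
  (innerSL ℂ ξ).smulRight η

section ApproximationNumbers

variable {H : Type*} [NormedAddCommGroup H] [InnerProductSpace ℂ H]

open scoped InnerProductSpace

lemma sValue_nonneg (a : H →L[ℂ] H) (n : ℕ) : 0 ≤ sValue a n := by
  refine Real.sInf_nonneg ?_
  rintro r ⟨F, -, rfl⟩
  exact norm_nonneg _

lemma sValue_le_of_rank_le {a F : H →L[ℂ] H} {n : ℕ}
    (hF : LinearMap.rank (F : H →ₗ[ℂ] H) ≤ (n : Cardinal)) : sValue a n ≤ ‖a - F‖ :=
  csInf_le ⟨0, by rintro r ⟨F, -, rfl⟩; exact norm_nonneg _⟩ ⟨F, hF, rfl⟩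

lemma le_sValue {a : H →L[ℂ] H} {n : ℕ} {r : ℝ}
    (h : ∀ F : H →L[ℂ] H, LinearMap.rank (F : H →ₗ[ℂ] H) ≤ (n : Cardinal) → r ≤ ‖a - F‖) :
    r ≤ sValue a n := by
  refine le_csInf ⟨‖a - 0‖, 0, ?_, rfl⟩ ?_
  · simp [LinearMap.rank_zero]
  · rintro _ ⟨F, hF, rfl⟩
    exact h F hF

lemma sValue_le_norm (a : H →L[ℂ] H) (n : ℕ) : sValue a n ≤ ‖a‖ := by
  simpa using sValue_le_of_rank_le (a := a) (F := 0) (n := n) (by simp [LinearMap.rank_zero])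

lemma sValue_zero (a : H →L[ℂ] H) : sValue a 0 = ‖a‖ := by
  refine le_antisymm (sValue_le_norm a 0) (le_sValue fun F hF => ?_)
  have h0 : LinearMap.rank (F : H →ₗ[ℂ] H) = 0 := by simpa using hF
  have h1 : (F : H →ₗ[ℂ] H) = 0 := by
    rw [LinearMap.rank, Submodule.rank_eq_zero] at h0
    exact LinearMap.range_eq_bot.1 h0
  have h2 : F = 0 := by ext x; exact congrArg (fun g : H →ₗ[ℂ] H => g x) h1
  simp [h2]

lemma sValue_eq_zero_of_rank_le {a : H →L[ℂ] H} {n : ℕ}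
    (ha : LinearMap.rank (a : H →ₗ[ℂ] H) ≤ (n : Cardinal)) : sValue a n = 0 :=
  le_antisymm (by simpa using sValue_le_of_rank_le (a := a) ha) (sValue_nonneg a n)

lemma rank_real_smul_le (c : ℝ) (a : H →L[ℂ] H) :
    LinearMap.rank ((c • a : H →L[ℂ] H) : H →ₗ[ℂ] H) ≤ LinearMap.rank (a : H →ₗ[ℂ] H) := by
  refine Submodule.rank_mono ?_
  rintro _ ⟨x, rfl⟩
  exact ⟨(c : ℂ) • x, by simp⟩

lemma sValue_real_smul_le {c : ℝ} (hc : 0 < c) (a : H →L[ℂ] H) (n : ℕ) :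
    sValue (c • a) n ≤ c * sValue a n := by
  rw [← div_le_iff₀' hc]
  refine le_sValue fun F hF => ?_
  rw [div_le_iff₀' hc]
  refine (sValue_le_of_rank_le ((rank_real_smul_le c F).trans hF)).trans_eq ?_
  rw [← smul_sub, norm_smul, Real.norm_of_nonneg hc.le]

lemma isCompactOperator_real_smul {a : H →L[ℂ] H} (ha : IsCompactOperator a) (c : ℝ) :
    IsCompactOperator (c • a : H →L[ℂ] H) := by
  have h : ⇑(c • a) = (c : ℂ) • ⇑a := by ext x; simp
  rw [h]
  exact ha.smul (c : ℂ)

/-- A multiple of a compact operator lies in the trace ball as soon as its approximation numbers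
are dominated by a summable sequence of the right sum. -/
lemma real_smul_mem_traceBall {a : H →L[ℂ] H} (ha : IsCompactOperator a) {b : ℕ → ℝ}
    (hab : ∀ n, sValue a n ≤ b n) (hb : Summable b) {c : ℝ} (hc : 0 < c)
    (hcb : c * ∑' n, b n ≤ 1) : c • a ∈ traceBall H := by
  have hle : ∀ n, sValue (c • a) n ≤ c * b n := fun n =>
    (sValue_real_smul_le hc a n).trans (by gcongr; exact hab n)
  have hs : Summable fun n => sValue (c • a) n :=
    (hb.mul_left c).of_nonneg_of_le (sValue_nonneg _) hle
  refine ⟨⟨isCompactOperator_real_smul ha c, hs⟩, le_trans ?_ hcb⟩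
  rw [← tsum_mul_left]
  exact hs.tsum_le_tsum hle (hb.mul_left c)

lemma exists_mem_ne_zero_of_rank_lt (K : Submodule ℂ H) {F : H →L[ℂ] H}
    (hF : LinearMap.rank (F : H →ₗ[ℂ] H) < Module.rank ℂ K) :
    ∃ x ∈ K, x ≠ 0 ∧ F x = 0 := by
  by_contra! h
  have hinj : Function.Injective ((F : H →ₗ[ℂ] H) ∘ₗ K.subtype) := by
    refine (injective_iff_map_eq_zero _).2 fun x hx => ?_
    by_contra hne
    exact h x x.2 (by simpa using hne) hx
  have h1 := LinearMap.rank_comp_le_left K.subtype (F : H →ₗ[ℂ] H)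
  rw [LinearMap.rank, rank_range_of_injective _ hinj] at h1
  exact absurd hF (not_lt.2 h1)

lemma isCompactOperator_of_finiteDimensional_range {a : H →L[ℂ] H} {K : Submodule ℂ H}
    [FiniteDimensional ℂ K] (ha : ∀ x, a x ∈ K) : IsCompactOperator a := by
  have h : IsCompactOperator (a.codRestrict K ha) :=
    haveI : ProperSpace K := FiniteDimensional.proper ℂ K
    isCompactOperator_of_locallyCompactSpace_dom (a.codRestrict K ha)
  exact h.clm_comp K.subtypeL

/-- A compact operator attains its norm at an eigenvector of `e^* e`. -/
lemma exists_norm_one_inner_map_map [CompleteSpace H] {e : H →L[ℂ] H} (he : IsCompactOperator e)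
    (hne : e ≠ 0) :
    ∃ u : H, ‖u‖ = 1 ∧ ∀ x, ⟪e u, e x⟫_ℂ = (‖e‖ : ℂ) ^ 2 * ⟪u, x⟫_ℂ := by
  set T : H →L[ℂ] H := ContinuousLinearMap.adjoint e ∘L e with hT
  have hTn : ‖T‖ = ‖e‖ ^ 2 := by
    rw [hT, ContinuousLinearMap.norm_adjoint_comp_self, sq]
  have hTc : IsCompactOperator T := he.clm_comp (ContinuousLinearMap.adjoint e)
  have hTs : IsSelfAdjoint T := ContinuousLinearMap.IsPositive.isSelfAdjoint
    (ContinuousLinearMap.isPositive_adjoint_comp_self e)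
  have : Nontrivial H := by
    by_contra h
    rw [not_nontrivial_iff_subsingleton] at h
    exact hne (Subsingleton.elim _ _)
  obtain ⟨z, hz, hzn⟩ := spectrum.exists_nnnorm_eq_spectralRadius T
  rw [hTs.spectralRadius_eq_nnnorm, ENNReal.coe_inj] at hzn
  have hzn' : ‖z‖ = ‖e‖ ^ 2 := by rw [← hTn]; exact congrArg NNReal.toReal hzn
  have hpos : 0 < ‖e‖ := norm_pos_iff.2 hne
  have hz0 : z ≠ 0 := by rw [← norm_pos_iff, hzn']; positivity
  obtain ⟨w, hw⟩ := ((hTc.hasEigenvalue_iff_mem_spectrum hz0).2 hz).exists_hasEigenvector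
  have hwn : ‖w‖ ≠ 0 := norm_ne_zero_iff.2 hw.2
  have hTw : T w = z • w := hw.apply_eq_smul
  have hinner : ∀ x, ⟪e w, e x⟫_ℂ = starRingEnd ℂ z * ⟪w, x⟫_ℂ := fun x => by
    rw [← inner_smul_left, ← hTw, hT, ContinuousLinearMap.comp_apply,
      ContinuousLinearMap.adjoint_inner_left]
  have hreal : starRingEnd ℂ z = (‖e‖ : ℂ) ^ 2 := by
    have h1 := hinner w
    rw [inner_self_eq_norm_sq_to_K, inner_self_eq_norm_sq_to_K] at h1
    have h2 : starRingEnd ℂ z = ((‖e w‖ ^ 2 / ‖w‖ ^ 2 : ℝ) : ℂ) := by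
      have : (‖w‖ : ℂ) ≠ 0 := by exact_mod_cast hwn
      push_cast
      rw [eq_div_iff (pow_ne_zero 2 this)]
      exact h1.symm
    have h3 : ‖e w‖ ^ 2 / ‖w‖ ^ 2 = ‖e‖ ^ 2 := by
      rw [← hzn', ← RCLike.norm_conj, h2, Complex.norm_real, Real.norm_of_nonneg (by positivity)]
    rw [h2, h3]
    push_cast
    rfl
  refine ⟨((‖w‖⁻¹ : ℝ) : ℂ) • w, ?_, fun x => ?_⟩
  · rw [norm_smul, Complex.norm_real, norm_inv, norm_norm, inv_mul_cancel₀ hwn]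
  · rw [map_smul, inner_smul_left, inner_smul_left, hinner, hreal]
    ring

/-- Removing a top singular vector from an operator shifts its approximation numbers. -/
lemma sValue_sub_le_sValue_succ {e q : H →L[ℂ] H} {u : H} (hu : ‖u‖ = 1)
    (he : ∀ x, ⟪e u, e x⟫_ℂ = (‖e‖ : ℂ) ^ 2 * ⟪u, x⟫_ℂ)
    (hq : ∀ x, q x = e (x - ⟪u, x⟫_ℂ • u)) (n : ℕ) :
    sValue q n ≤ sValue e (n + 1) := by
  have huu : ⟪u, u⟫_ℂ = 1 := by rw [inner_self_eq_norm_sq_to_K, hu]; simp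
  have heu : ‖e u‖ = ‖e‖ := by
    have h1 := he u
    rw [huu, inner_self_eq_norm_sq_to_K, mul_one] at h1
    have h2 : ‖e u‖ ^ 2 = ‖e‖ ^ 2 := Complex.ofReal_injective (by push_cast; exact h1)
    exact (pow_left_inj₀ (norm_nonneg _) (norm_nonneg _) two_ne_zero).1 h2
  have hux : ∀ x, ⟪u, x - ⟪u, x⟫_ℂ • u⟫_ℂ = 0 := fun x => by
    rw [inner_sub_right, inner_smul_right, huu, mul_one, sub_self]
  have hxle : ∀ x, ‖x - ⟪u, x⟫_ℂ • u‖ ≤ ‖x‖ := fun x => by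
    have h := norm_add_sq_eq_norm_sq_add_norm_sq_of_inner_eq_zero
      (𝕜 := ℂ) (x - ⟪u, x⟫_ℂ • u) (⟪u, x⟫_ℂ • u)
      (by rw [inner_smul_right, inner_eq_zero_symm.1 (hux x), mul_zero])
    rw [sub_add_cancel] at h
    nlinarith [norm_nonneg x, norm_nonneg (x - ⟪u, x⟫_ℂ • u), norm_nonneg (⟪u, x⟫_ℂ • u)]
  refine le_sValue fun F hF => ?_
  rcases le_or_gt ‖e‖ ‖e - F‖ with hr | hr
  · refine (sValue_le_norm q n).trans (le_trans ?_ hr)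
    refine q.opNorm_le_bound (norm_nonneg _) fun x => ?_
    rw [hq]
    exact (e.le_opNorm _).trans (by gcongr; exact hxle x)
  have hα : ⟪e u, F u⟫_ℂ ≠ 0 := by
    intro h0
    have h1 : ⟪e u, (e - F) u⟫_ℂ = (‖e‖ : ℂ) ^ 2 := by
      rw [sub_apply, inner_sub_right, h0, he, huu]; simp
    have h2 := norm_inner_le_norm (𝕜 := ℂ) (e u) ((e - F) u)
    have h3 := (e - F).le_opNorm u
    rw [h1, heu] at h2
    rw [hu, mul_one] at h3
    simp only [norm_pow, Complex.norm_real, norm_norm] at h2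
    nlinarith [norm_nonneg (e - F), norm_nonneg e]
  set α := ⟪e u, F u⟫_ℂ with hαdef
  -- the Schur complement of the corner `α` in `F`
  set G : H →L[ℂ] H := F - ((α⁻¹ • innerSL ℂ (e u)) ∘L F).smulRight (F u) with hG
  have hGx : ∀ x, G x = F (x - (α⁻¹ * ⟪e u, F x⟫_ℂ) • u) := fun x => by
    simp [hG]
  have hGorth : ∀ x, ⟪e u, G x⟫_ℂ = 0 := fun x => by
    rw [hGx, map_sub, map_smul, inner_sub_right, inner_smul_right, ← hαdef]
    field_simp
    ring
  have hGu : G u = 0 := by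
    rw [hGx, ← hαdef, inv_mul_cancel₀ hα]; simp
  have hGrank : LinearMap.rank (G : H →ₗ[ℂ] H) ≤ (n : Cardinal) := by
    have hfin : FiniteDimensional ℂ (LinearMap.range (F : H →ₗ[ℂ] H)) :=
      Module.rank_lt_aleph0_iff.1 (lt_of_le_of_lt hF Cardinal.natCast_lt_aleph0)
    have hlt : LinearMap.range (G : H →ₗ[ℂ] H) < LinearMap.range (F : H →ₗ[ℂ] H) := by
      refine lt_of_le_of_ne ?_ fun heq => ?_
      · rintro _ ⟨x, rfl⟩
        exact ⟨_, (hGx x).symm⟩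
      · have hmem : F u ∈ LinearMap.range (G : H →ₗ[ℂ] H) := heq ▸ ⟨u, rfl⟩
        obtain ⟨x, hx⟩ := hmem
        have hx' : G x = F u := hx
        exact hα (by rw [hαdef, ← hx', hGorth])
    have hfinG : FiniteDimensional ℂ (LinearMap.range (G : H →ₗ[ℂ] H)) :=
      Submodule.finiteDimensional_of_le hlt.le
    have h1 := Submodule.finrank_lt_finrank_of_lt hlt
    rw [LinearMap.rank, ← Module.finrank_eq_rank] at hF ⊢
    norm_cast at hF ⊢
    lia
  refine (sValue_le_of_rank_le hGrank).trans ?_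
  refine ContinuousLinearMap.opNorm_le_bound _ (norm_nonneg _) fun x => ?_
  set y := x - ⟪u, x⟫_ℂ • u with hy
  set w : ℂ := -(α⁻¹ * ⟪e u, F y⟫_ℂ) with hw
  have hGy : G x = F (y + w • u) := by
    have h1 : G x = G y := by rw [hy, map_sub, map_smul, hGu]; simp
    rw [h1, hGx, hw, neg_smul, sub_eq_add_neg]
  have hz : (e - F) (y + w • u) = (q - G) x + w • e u := by
    rw [sub_apply, sub_apply, ← hGy, hq, map_add, map_smul]
    abel
  have horth1 : ⟪(q - G) x, w • e u⟫_ℂ = 0 := by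
    have h1 : ⟪e u, (q - G) x⟫_ℂ = 0 := by
      rw [sub_apply, inner_sub_right, hGorth, hq, he, hux]; simp
    rw [inner_smul_right, ← inner_conj_symm, h1]; simp
  have horth2 : ⟪y, w • u⟫_ℂ = 0 := by
    rw [inner_smul_right, ← inner_conj_symm, hux]; simp
  have h1 := norm_add_sq_eq_norm_sq_add_norm_sq_of_inner_eq_zero _ _ horth1
  have h2 := norm_add_sq_eq_norm_sq_add_norm_sq_of_inner_eq_zero _ _ horth2
  rw [← hz, norm_smul, heu] at h1
  rw [norm_smul, hu, mul_one] at h2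
  have h3 := (e - F).le_opNorm (y + w • u)
  have h4 : ‖(e - F) (y + w • u)‖ ^ 2 ≤ ‖e - F‖ ^ 2 * ‖y + w • u‖ ^ 2 := by
    rw [← mul_pow]; gcongr
  have h5 : ‖e - F‖ ^ 2 ≤ ‖e‖ ^ 2 := by gcongr
  have h6 : ‖(q - G) x‖ ^ 2 ≤ (‖e - F‖ * ‖y‖) ^ 2 := by
    nlinarith [mul_nonneg (sub_nonneg.2 h5) (sq_nonneg ‖w‖)]
  have h7 := abs_le_of_sq_le_sq h6 (by positivity)
  exact (le_abs_self _).trans (h7.trans (by gcongr; exact hxle x))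

/-- Extreme points of the unit ball of the trace class have rank at most one. -/
lemma rank_le_one_of_mem_extremePoints [CompleteSpace H] {e : H →L[ℂ] H}
    (he : e ∈ Set.extremePoints ℝ (traceBall H)) :
    LinearMap.rank (e : H →ₗ[ℂ] H) ≤ 1 := by
  obtain ⟨⟨⟨hc, hs⟩, hle⟩, hext⟩ := he
  rcases eq_or_ne e 0 with rfl | hne
  · simp [LinearMap.rank_zero]
  obtain ⟨u, hu, hinner⟩ := exists_norm_one_inner_map_map hc hne
  have hpos : 0 < ‖e‖ := norm_pos_iff.2 hne
  set p : H →L[ℂ] H := rankOneOp (e u) u with hp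
  have hpx : ∀ x, p x = ⟪u, x⟫_ℂ • e u := fun x => rfl
  set q : H →L[ℂ] H := e - p with hq
  have hqx : ∀ x, q x = e (x - ⟪u, x⟫_ℂ • u) := fun x => by
    rw [hq, sub_apply, hpx, map_sub, map_smul]
  have hprange : ∀ x, p x ∈ Submodule.span ℂ {e u} := fun x =>
    Submodule.smul_mem _ _ (Submodule.mem_span_singleton_self _)
  have hprank : LinearMap.rank (p : H →ₗ[ℂ] H) ≤ 1 := by
    refine (Submodule.rank_mono (t := Submodule.span ℂ {e u}) ?_).trans ?_
    · rintro _ ⟨x, rfl⟩; exact hprange x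
    · exact (rank_span_le _).trans (by simp)
  have hpc : IsCompactOperator p := isCompactOperator_of_finiteDimensional_range hprange
  have hpn : ‖p‖ ≤ ‖e‖ := by
    refine p.opNorm_le_bound hpos.le fun x => ?_
    rw [hpx, norm_smul, mul_comm]
    have h1 := norm_inner_le_norm (𝕜 := ℂ) u x
    have h2 := e.le_opNorm u
    rw [hu, one_mul] at h1
    rw [hu, mul_one] at h2
    gcongr
  have hqs : ∀ n, sValue q n ≤ sValue e (n + 1) := sValue_sub_le_sValue_succ hu hinner hqx
  have hs' : Summable fun n => sValue e (n + 1) := (summable_nat_add_iff 1).2 hs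
  have hsum : ∑' n, sValue e (n + 1) ≤ 1 - ‖e‖ := by
    have h1 := hs.tsum_eq_zero_add
    rw [sValue_zero] at h1
    rw [traceNorm] at hle
    linarith
  have hqnorm : ‖q‖ ≤ 1 - ‖e‖ := by
    rw [← sValue_zero]
    refine (hqs 0).trans (le_trans ?_ hsum)
    exact hs'.le_tsum 0 fun n _ => sValue_nonneg _ _
  rcases (sub_nonneg.1 ((norm_nonneg q).trans hqnorm)).eq_or_lt with h1 | h1
  · have hq0 : q = 0 := by rw [← norm_le_zero_iff]; linarith
    have hep : e = p := sub_eq_zero.1 hq0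
    rw [hep]
    exact hprank
  have hpmem : ‖e‖⁻¹ • p ∈ traceBall H := by
    refine real_smul_mem_traceBall hpc (b := fun n => if n = 0 then ‖e‖ else 0) (fun n => ?_)
      (summable_of_ne_finset_zero (s := {0}) fun n hn => by
        rw [if_neg (by simpa using hn)])
      (inv_pos.2 hpos) ?_
    · rcases eq_or_ne n 0 with rfl | hn
      · simpa using (sValue_le_norm p 0).trans hpn
      · simp only [hn, if_false]
        refine (sValue_eq_zero_of_rank_le (hprank.trans ?_)).le
        exact_mod_cast Nat.one_le_iff_ne_zero.2 hn
    · rw [tsum_ite_eq, inv_mul_cancel₀ hpos.ne']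
  have hqmem : (1 - ‖e‖)⁻¹ • q ∈ traceBall H := by
    refine real_smul_mem_traceBall (hc.sub hpc) hqs hs' (inv_pos.2 (sub_pos.2 h1)) ?_
    rw [inv_mul_le_iff₀ (sub_pos.2 h1), mul_one]
    exact hsum
  have hseg : e ∈ openSegment ℝ (‖e‖⁻¹ • p) ((1 - ‖e‖)⁻¹ • q) := by
    refine ⟨‖e‖, 1 - ‖e‖, hpos, sub_pos.2 h1, by ring, ?_⟩
    rw [smul_inv_smul₀ hpos.ne', smul_inv_smul₀ (sub_pos.2 h1).ne', hq, add_sub_cancel]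
  have hep : ‖e‖⁻¹ • p = e := hext hpmem hqmem hseg
  rw [← hep]
  exact (rank_real_smul_le _ _).trans hprank

lemma inv_le_norm_smul_starProjection_sub {K : Submodule ℂ H} [K.HasOrthogonalProjection]
    {c : ℝ} (hc : 0 ≤ c) {F : H →L[ℂ] H}
    (hF : LinearMap.rank (F : H →ₗ[ℂ] H) < Module.rank ℂ K) :
    c ≤ ‖c • K.starProjection - F‖ := by
  obtain ⟨x, hxK, hx0, hFx⟩ := exists_mem_ne_zero_of_rank_lt K hF
  have h := (c • K.starProjection - F).le_opNorm x
  rw [sub_apply, smul_apply, hFx, sub_zero,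
    Submodule.starProjection_eq_self_iff.2 hxK, norm_smul, Real.norm_of_nonneg hc] at h
  exact le_of_mul_le_mul_right h (norm_pos_iff.2 hx0)

/-- The normalized projection onto a subspace of dimension `n` lies in the trace ball. -/
lemma inv_smul_starProjection_mem_traceBall {K : Submodule ℂ H} [FiniteDimensional ℂ K]
    {n : ℕ} (hn : 0 < n) (hK : Module.finrank ℂ K = n) :
    (n : ℝ)⁻¹ • K.starProjection ∈ traceBall H := by
  have hmem : ∀ x, K.starProjection x ∈ K := fun x => K.starProjection_apply_mem x
  have hsum : Summable fun k => if k < n then (1 : ℝ) else 0 :=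
    summable_of_ne_finset_zero (s := Finset.range n) fun k hk => by simpa using hk
  refine real_smul_mem_traceBall (isCompactOperator_of_finiteDimensional_range hmem)
    (b := fun k => if k < n then (1 : ℝ) else 0) (fun k => ?_) hsum (by positivity) ?_
  · split_ifs with hk
    · exact (sValue_le_norm _ _).trans K.starProjection_norm_le
    · refine (sValue_eq_zero_of_rank_le ?_).le
      refine (Submodule.rank_mono (t := K) ?_).trans ?_
      · rintro _ ⟨x, rfl⟩; exact hmem x
      · rw [← Module.finrank_eq_rank, hK]
        exact_mod_cast not_lt.1 hk
  · rw [tsum_eq_sum (s := Finset.range n) fun k hk => by simpa using hk,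
      Finset.sum_congr rfl fun k hk => if_pos (Finset.mem_range.1 hk)]
    simp [hn.ne']

lemma lambdaFn_inv_smul_starProjection_le [CompleteSpace H] {K : Submodule ℂ H}
    [FiniteDimensional ℂ K] {n : ℕ} (hK : Module.finrank ℂ K = n + 1) :
    lambdaFn (((n + 1 : ℕ) : ℝ)⁻¹ • K.starProjection) ≤ ((n + 1 : ℕ) : ℝ)⁻¹ := by
  refine Real.sSup_le ?_ (by positivity)
  rintro t ⟨⟨ht0, ht1⟩, e, he, y, ⟨⟨-, hys⟩, hy1⟩, hey⟩
  rcases ht1.eq_or_lt with rfl | ht1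
  · have hae : (((n + 1 : ℕ) : ℝ)⁻¹ • K.starProjection : H →L[ℂ] H) = e := by simpa using hey
    rcases n.eq_zero_or_pos with rfl | hn
    · simp
    have hrank : LinearMap.rank (e : H →ₗ[ℂ] H) < Module.rank ℂ K := by
      rw [← Module.finrank_eq_rank, hK]
      refine (rank_le_one_of_mem_extremePoints he).trans_lt ?_
      exact_mod_cast Nat.succ_lt_succ hn
    have hle := inv_le_norm_smul_starProjection_sub (c := ((n + 1 : ℕ) : ℝ)⁻¹)
      (by positivity) hrank
    rw [hae, sub_self, norm_zero] at hle
    have hpos : 0 < ((n + 1 : ℕ) : ℝ)⁻¹ := by positivity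
    exact absurd hle (not_le.2 hpos)
  have hlow : ∀ k < n, ((n + 1 : ℕ) : ℝ)⁻¹ ≤ (1 - t) * sValue y k := fun k hk => by
    rw [← div_le_iff₀' (sub_pos.2 ht1)]
    refine le_sValue fun F hF => ?_
    rw [div_le_iff₀' (sub_pos.2 ht1)]
    have hrank : LinearMap.rank ((t • e + (1 - t) • F : H →L[ℂ] H) : H →ₗ[ℂ] H)
        < Module.rank ℂ K := by
      rw [← Module.finrank_eq_rank, hK]
      refine lt_of_le_of_lt (LinearMap.rank_add_le ((t • e : H →L[ℂ] H) : H →ₗ[ℂ] H)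
        (((1 - t) • F : H →L[ℂ] H) : H →ₗ[ℂ] H)) ?_
      refine lt_of_le_of_lt (add_le_add
        ((rank_real_smul_le _ _).trans (rank_le_one_of_mem_extremePoints he))
        ((rank_real_smul_le _ _).trans hF)) ?_
      norm_cast
      lia
    refine (inv_le_norm_smul_starProjection_sub (by positivity) hrank).trans_eq ?_
    rw [hey, add_sub_add_left_eq_sub, ← smul_sub, norm_smul,
      Real.norm_of_nonneg (sub_pos.2 ht1).le]
  have hsum : (n : ℝ) * ((n + 1 : ℕ) : ℝ)⁻¹ ≤ 1 - t := by
    calc (n : ℝ) * ((n + 1 : ℕ) : ℝ)⁻¹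
        = ∑ k ∈ Finset.range n, ((n + 1 : ℕ) : ℝ)⁻¹ := by simp
      _ ≤ ∑ k ∈ Finset.range n, (1 - t) * sValue y k :=
          Finset.sum_le_sum fun k hk => hlow k (Finset.mem_range.1 hk)
      _ = (1 - t) * ∑ k ∈ Finset.range n, sValue y k := by rw [Finset.mul_sum]
      _ ≤ (1 - t) * 1 := by
          have := (hys.sum_le_tsum (Finset.range n) fun k _ => sValue_nonneg y k).trans hy1
          have := (sub_pos.2 ht1).le
          gcongr
      _ = 1 - t := mul_one _
  have : (n : ℝ) * ((n + 1 : ℕ) : ℝ)⁻¹ = 1 - ((n + 1 : ℕ) : ℝ)⁻¹ := by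
    push_cast
    field_simp
    ring
  linarith

end ApproximationNumbers

/-- Let `H` be an infinite-dimensional complex Hilbert space. Then `C₁(H)`
fails the uniform λ-property; more precisely,
`inf { λ(a) : a in the closed unit ball of C₁(H) } = 0`. -/
theorem traceClass_fails_uniform_lambdaProperty {H : Type*} [NormedAddCommGroup H]
    [InnerProductSpace ℂ H] [CompleteSpace H] (hH : ¬ FiniteDimensional ℂ H) :
    sInf (lambdaFn '' traceBall H) = 0 := by
  have hnonneg : ∀ r ∈ lambdaFn '' traceBall H, (0 : ℝ) ≤ r := by
    rintro _ ⟨a, -, rfl⟩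
    exact Real.sSup_nonneg fun t ht => ht.1.1
  refine le_antisymm (le_of_forall_pos_le_add fun ε hε => ?_) (Real.sInf_nonneg hnonneg)
  obtain ⟨n, hn⟩ := exists_nat_one_div_lt hε
  have hrank : ((n + 1 : ℕ) : Cardinal) ≤ Module.rank ℂ H :=
    Cardinal.natCast_le_aleph0.trans (not_lt.1 fun h => hH (Module.rank_lt_aleph0_iff.1 h))
  obtain ⟨s, hs, hli⟩ := exists_finset_linearIndependent_of_le_rank hrank
  have hK : Module.finrank ℂ (Submodule.span ℂ (s : Set H)) = n + 1 := by
    rw [finrank_span_finset_eq_card hli, hs]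
  refine (csInf_le ⟨0, hnonneg⟩ ⟨_, inv_smul_starProjection_mem_traceBall n.succ_pos hK, rfl⟩).trans
    ((lambdaFn_inv_smul_starProjection_le hK).trans ?_)
  rw [zero_add, ← one_div]
  exact_mod_cast hn.le
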